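/- Let U ⊆ ℝ² be open and a, b : U → ℝ smooth functions satisfying the Cauchy–Riemann equations ∂₁a = ∂₂b and ∂₂a = −∂₁b. Define N¹₁ = a, N¹₂ = −b, N²₁ = b, N²₂ = a. Let g : U → GL_m(ℂ) be a twice continuously differentiable map with values in invertible m×m matrices. Then g satisfies Σ_λ [ ∂_μ( (∂_λ g) g^{-1} ) N^λ_ν − ∂_ν( (∂_λ g) g^{-1} ) N^λ_μ ] − Σ_λ (∂_λ g) g^{-1} ( ∂_ν N^λ_μ − ∂_μ N^λ_ν ) = 0 for all μ, ν ∈ {1,2} if and only if g satisfies the non-autonomous chiral model equation b·( ∂₁((∂₁g) g^{-1}) + ∂₂((∂₂g) g^{-1}) ) = a·[ (∂₁g) g^{-1} , (∂₂g) g^{-1} ]. -/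

import Mathlib

open scoped BigOperators

/-- Partial derivative of a real-valued function on `ℝⁿ` in the `μ`-th coordinate direction. -/
noncomputable def pd {n : ℕ} (μ : Fin n) (f : (Fin n → ℝ) → ℝ) (x : Fin n → ℝ) : ℝ :=
  fderiv ℝ f x (Pi.single μ 1)

/-- Entrywise partial derivative of a matrix-valued function on `ℝⁿ`. -/
noncomputable def pdM {n m r : ℕ} (μ : Fin n) (f : (Fin n → ℝ) → Matrix (Fin m) (Fin r) ℂ)
    (x : Fin n → ℝ) : Matrix (Fin m) (Fin r) ℂ :=
  Matrix.of fun i j => fderiv ℝ (fun y => f y i j) x (Pi.single μ 1)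

theorem differentiableAt_matrix_det {E : Type*} [NormedAddCommGroup E] [NormedSpace ℝ E] {m : ℕ}
    {f : E → Matrix (Fin m) (Fin m) ℂ} {x : E}
    (hf : ∀ i j, DifferentiableAt ℝ (fun y => f y i j) x) :
    DifferentiableAt ℝ (fun y => (f y).det) x := by
  simp only [Matrix.det_apply]
  refine DifferentiableAt.fun_sum fun σ _ => ?_
  have h : DifferentiableAt ℝ (fun y => ∏ i, f y (σ i) i) x :=
    (HasFDerivAt.finsetProd fun i _ => (hf (σ i) i).hasFDerivAt).differentiableAt
  simp only [Units.smul_def, zsmul_eq_mul]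
  exact h.const_mul _

theorem differentiableAt_matrix_inv {E : Type*} [NormedAddCommGroup E] [NormedSpace ℝ E] {m : ℕ}
    {f : E → Matrix (Fin m) (Fin m) ℂ} {x : E}
    (hf : ∀ i j, DifferentiableAt ℝ (fun y => f y i j) x) (hx : IsUnit (f x)) (i j : Fin m) :
    DifferentiableAt ℝ (fun y => (f y)⁻¹ i j) x := by
  have hdet : (f x).det ≠ 0 := ((Matrix.isUnit_iff_isUnit_det _).1 hx).ne_zero
  have hadj : DifferentiableAt ℝ (fun y => (f y).adjugate i j) x := by
    simp only [Matrix.adjugate_apply]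
    refine differentiableAt_matrix_det fun k l => ?_
    simp only [Matrix.updateRow_apply]
    split_ifs
    · exact differentiableAt_const _
    · exact hf k l
  simp only [Matrix.inv_def, Ring.inverse_eq_inv', Matrix.smul_apply, smul_eq_mul]
  exact ((differentiableAt_matrix_det hf).inv hdet).mul hadj

theorem differentiableAt_matrix_mul {E : Type*} [NormedAddCommGroup E] [NormedSpace ℝ E]
    {m r s : ℕ} {f : E → Matrix (Fin m) (Fin r) ℂ} {h : E → Matrix (Fin r) (Fin s) ℂ} {x : E}
    (hf : ∀ i j, DifferentiableAt ℝ (fun y => f y i j) x)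
    (hh : ∀ i j, DifferentiableAt ℝ (fun y => h y i j) x) (i : Fin m) (j : Fin s) :
    DifferentiableAt ℝ (fun y => (f y * h y) i j) x := by
  simp only [Matrix.mul_apply]
  exact DifferentiableAt.fun_sum fun k _ => (hf i k).mul (hh k j)

theorem pdM_mul {n m r s : ℕ} (μ : Fin n) {f : (Fin n → ℝ) → Matrix (Fin m) (Fin r) ℂ}
    {h : (Fin n → ℝ) → Matrix (Fin r) (Fin s) ℂ} {x : Fin n → ℝ}
    (hf : ∀ i j, DifferentiableAt ℝ (fun y => f y i j) x)
    (hh : ∀ i j, DifferentiableAt ℝ (fun y => h y i j) x) :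
    pdM μ (fun y => f y * h y) x = pdM μ f x * h x + f x * pdM μ h x := by
  ext i j
  simp only [pdM, Matrix.of_apply, Matrix.add_apply, Matrix.mul_apply]
  rw [fderiv_fun_sum fun k _ => (hf i k).fun_mul (hh k j), ← Finset.sum_add_distrib]
  simp only [sum_apply]
  refine Finset.sum_congr rfl fun k _ => ?_
  rw [fderiv_fun_mul (hf i k) (hh k j)]
  simp
  ring

theorem pdM_congr {n m r : ℕ} (μ : Fin n) {f h : (Fin n → ℝ) → Matrix (Fin m) (Fin r) ℂ}
    {x : Fin n → ℝ} (hfh : f =ᶠ[nhds x] h) : pdM μ f x = pdM μ h x := by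
  ext i j
  simp only [pdM, Matrix.of_apply]
  rw [Filter.EventuallyEq.fderiv_eq (hfh.mono fun y hy => congrFun (congrFun hy i) j)]

theorem differentiableAt_pdM {n m r : ℕ} (μ : Fin n)
    {f : (Fin n → ℝ) → Matrix (Fin m) (Fin r) ℂ} {x : Fin n → ℝ}
    (hf : ∀ i j, ContDiffAt ℝ 2 (fun y => f y i j) x) (i : Fin m) (j : Fin r) :
    DifferentiableAt ℝ (fun y => pdM μ f y i j) x := by
  have h : ContDiffAt ℝ 1 (fderiv ℝ fun y => f y i j) x := (hf i j).fderiv_right (by norm_num)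
  exact (h.differentiableAt (by norm_num)).clm_apply (differentiableAt_const _)

theorem pdM_comm {n m r : ℕ} (μ ν : Fin n)
    {f : (Fin n → ℝ) → Matrix (Fin m) (Fin r) ℂ} {x : Fin n → ℝ}
    (hf : ∀ i j, ContDiffAt ℝ 2 (fun y => f y i j) x) :
    pdM μ (pdM ν f) x = pdM ν (pdM μ f) x := by
  ext i j
  have h : ContDiffAt ℝ 1 (fderiv ℝ fun y => f y i j) x := (hf i j).fderiv_right (by norm_num)
  have hd := h.differentiableAt (by norm_num)
  have key : ∀ v w : Fin n → ℝ, fderiv ℝ (fun y => fderiv ℝ (fun z => f z i j) y v) x w =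
      fderiv ℝ (fderiv ℝ fun z => f z i j) x w v := fun v w => by
    rw [fderiv_clm_apply hd (differentiableAt_const _)]
    simp
  simp only [pdM, Matrix.of_apply]
  rw [key, key]
  exact (hf i j).isSymmSndFDerivAt (by simp) _ _

/-- The logarithmic derivatives `(∂_μ g) g⁻¹` of an invertible matrix function satisfy the
zero-curvature identity. -/
theorem pdM_mul_inv_sub_pdM_mul_inv {n m : ℕ} (μ ν : Fin n)
    {g : (Fin n → ℝ) → Matrix (Fin m) (Fin m) ℂ} {x : Fin n → ℝ}
    (hg : ∀ i j, ContDiffAt ℝ 2 (fun y => g y i j) x) (hx : ∀ᶠ y in nhds x, IsUnit (g y)) :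
    pdM μ (fun y => pdM ν g y * (g y)⁻¹) x - pdM ν (fun y => pdM μ g y * (g y)⁻¹) x =
      pdM μ g x * (g x)⁻¹ * (pdM ν g x * (g x)⁻¹) -
        pdM ν g x * (g x)⁻¹ * (pdM μ g x * (g x)⁻¹) := by
  have hd : ∀ i j, DifferentiableAt ℝ (fun y => g y i j) x :=
    fun i j => (hg i j).differentiableAt (by norm_num)
  have hu := (Matrix.isUnit_iff_isUnit_det _).1 hx.self_of_nhds
  have key : ∀ κ l : Fin n, pdM κ (fun y => pdM l g y * (g y)⁻¹) x =
      pdM κ (pdM l g) x * (g x)⁻¹ - pdM l g x * (g x)⁻¹ * (pdM κ g x * (g x)⁻¹) := by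
    intro κ l
    have hA := differentiableAt_matrix_mul (differentiableAt_pdM l hg)
      (differentiableAt_matrix_inv hd hx.self_of_nhds)
    have h1 : pdM κ (fun y => pdM l g y * (g y)⁻¹ * g y) x = pdM κ (pdM l g) x :=
      pdM_congr κ (hx.mono fun y hy =>
        Matrix.nonsing_inv_mul_cancel_right _ _ ((Matrix.isUnit_iff_isUnit_det _).1 hy))
    rw [pdM_mul κ hA hd] at h1
    rw [← h1, add_mul, Matrix.mul_nonsing_inv_cancel_right _ _ hu, Matrix.mul_assoc _ (pdM κ g x),
      add_sub_cancel_right]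
  rw [key, key, pdM_comm μ ν hg]
  abel

theorem pd_neg {n : ℕ} (μ : Fin n) (f : (Fin n → ℝ) → ℝ) (x : Fin n → ℝ) :
    pd μ (-f) x = -pd μ f x := by
  simp [pd, fderiv_neg]

/-- for `N = ((a, −b), (b, a))` with Cauchy–Riemann `a, b`, a C² map
`g : U → GL_m(ℂ)` satisfies the general coordinate equation iff it satisfies the
non-autonomous chiral model equation. -/
theorem statement4 {m : ℕ} (U : Set (Fin 2 → ℝ)) (hU : IsOpen U)
    (a b : (Fin 2 → ℝ) → ℝ)
    (ha : ContDiffOn ℝ (⊤ : ℕ∞) a U) (hb : ContDiffOn ℝ (⊤ : ℕ∞) b U)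
    (hCR1 : ∀ x ∈ U, pd 0 a x = pd 1 b x) (hCR2 : ∀ x ∈ U, pd 1 a x = -(pd 0 b x))
    (N : Fin 2 → Fin 2 → (Fin 2 → ℝ) → ℝ)
    (hN : N = ![![a, -b], ![b, a]])
    (g : (Fin 2 → ℝ) → Matrix (Fin m) (Fin m) ℂ)
    (hg : ∀ i j, ContDiffOn ℝ 2 (fun y => g y i j) U)
    (hginv : ∀ x ∈ U, IsUnit (g x)) :
    (∀ x ∈ U, ∀ μ ν : Fin 2,
        (∑ l, (N l ν x • pdM μ (fun y => pdM l g y * (g y)⁻¹) x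
              - N l μ x • pdM ν (fun y => pdM l g y * (g y)⁻¹) x))
          - (∑ l, (pd ν (N l μ) x - pd μ (N l ν) x) • (pdM l g x * (g x)⁻¹))
        = 0)
      ↔ (∀ x ∈ U,
          b x • (pdM 0 (fun y => pdM 0 g y * (g y)⁻¹) x
                + pdM 1 (fun y => pdM 1 g y * (g y)⁻¹) x)
            = a x • ((pdM 0 g x * (g x)⁻¹) * (pdM 1 g x * (g x)⁻¹)
                    - (pdM 1 g x * (g x)⁻¹) * (pdM 0 g x * (g x)⁻¹))) := by
  subst hN
  refine forall₂_congr fun x hx => ?_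
  have hxU := hU.mem_nhds hx
  have hcurv := pdM_mul_inv_sub_pdM_mul_inv 0 1 (fun i j => (hg i j).contDiffAt hxU)
    (Filter.eventually_of_mem hxU hginv)
  rw [← hcurv]
  simp only [Fin.forall_fin_two, Fin.sum_univ_two, Matrix.cons_val_zero, Matrix.cons_val_one,
    Pi.neg_apply, pd_neg, hCR1 x hx, hCR2 x hx, sub_self, neg_smul, sub_neg_eq_add,
    neg_add_cancel, zero_smul, add_zero, sub_zero, true_and, and_true]
  generalize pdM 0 (fun y => pdM 0 g y * (g y)⁻¹) x = P
  generalize pdM 0 (fun y => pdM 1 g y * (g y)⁻¹) x = Q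
  generalize pdM 1 (fun y => pdM 0 g y * (g y)⁻¹) x = R
  generalize pdM 1 (fun y => pdM 1 g y * (g y)⁻¹) x = S
  constructor
  · rintro ⟨h, -⟩
    rw [← sub_eq_zero, ← neg_eq_zero, ← h]
    module
  · intro h
    rw [← sub_eq_zero] at h
    constructor
    · rw [← neg_eq_zero, ← h]
      module
    · rw [← h]
      module
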